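/- Let E be a complete real normed vector space (a real Banach space), let f : E → E be Lipschitz with constant k where 0 ≤ k < 1, let q* be the unique fixed point of f, and let β satisfy 0 < β < 2/(k+1). Let (y_n, z_n) be the sequence generated by the reversible fixed-point iteration from an initial pair with y_0 = z_0, and set L = |1−β| + β·k. Then for all n ≥ 0, ‖y_n − q*‖ ≤ L^n · ‖y_0 − q*‖ and ‖z_n − q*‖ ≤ L^n · ‖z_0 − q*‖. -/

import Mathlib

/-- One relaxed step `(1 - β) • u + β • f v` of a Lipschitz map `f` with fixed point `q`. -/
theorem norm_relaxed_step_sub_le {E : Type*} [NormedAddCommGroup E] [NormedSpace ℝ E]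
    {f : E → E} {k β : ℝ} {q : E} (hf : ∀ a b : E, ‖f a - f b‖ ≤ k * ‖a - b‖)
    (hq : f q = q) (hβ : 0 ≤ β) (u v : E) :
    ‖(1 - β) • u + β • f v - q‖ ≤ |1 - β| * ‖u - q‖ + β * (k * ‖v - q‖) := by
  have hsplit : (1 - β) • u + β • f v - q = (1 - β) • (u - q) + β • (f v - f q) := by
    rw [hq]
    module
  rw [hsplit]
  refine (norm_add_le _ _).trans ?_
  rw [norm_smul, norm_smul, Real.norm_eq_abs, Real.norm_eq_abs, abs_of_nonneg hβ]
  gcongr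
  exact hf v q

/-- Componentwise linear convergence of the reversible fixed-point iteration when
started on the diagonal `y 0 = z 0`: `‖y_n − q*‖ ≤ L^n·‖y_0 − q*‖` and
`‖z_n − q*‖ ≤ L^n·‖z_0 − q*‖` with `L = |1−β| + β·k`. -/
theorem reversible_iteration_componentwise_convergence {E : Type*}
    [NormedAddCommGroup E] [NormedSpace ℝ E] [CompleteSpace E]
    (f : E → E) (k : ℝ) (hk0 : 0 ≤ k) (hk1 : k < 1)
    (hf : ∀ a b : E, ‖f a - f b‖ ≤ k * ‖a - b‖)
    (qstar : E) (hq : f qstar = qstar)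
    (β : ℝ) (hβ0 : 0 < β) (hβ2 : β < 2 / (k + 1))
    (y z : ℕ → E) (h0 : y 0 = z 0)
    (hy : ∀ n, y (n + 1) = (1 - β) • y n + β • f (z n))
    (hz : ∀ n, z (n + 1) = (1 - β) • z n + β • f (y (n + 1)))
    (L : ℝ) (hL : L = |1 - β| + β * k) :
    ∀ n : ℕ,
      ‖y n - qstar‖ ≤ L ^ n * ‖y 0 - qstar‖ ∧
        ‖z n - qstar‖ ≤ L ^ n * ‖z 0 - qstar‖ := by
  have hL0 : 0 ≤ L := by rw [hL]; positivity
  have hL1 : L ≤ 1 := by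
    rw [lt_div_iff₀ (by linarith)] at hβ2
    have hβk : β * k ≤ β := mul_le_of_le_one_right hβ0.le hk1.le
    have habs : |1 - β| ≤ 1 - β * k := abs_le.mpr ⟨by linarith, by linarith⟩
    linarith
  intro n
  rw [← h0]
  induction n with
  | zero => simp [h0]
  | succ n ih =>
    obtain ⟨ihy, ihz⟩ := ih
    have hyn : ‖y (n + 1) - qstar‖ ≤ L ^ (n + 1) * ‖y 0 - qstar‖ := by
      rw [hy]
      calc _ ≤ |1 - β| * ‖y n - qstar‖ + β * (k * ‖z n - qstar‖) :=
            norm_relaxed_step_sub_le hf hq hβ0.le _ _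
        _ ≤ |1 - β| * (L ^ n * ‖y 0 - qstar‖) + β * (k * (L ^ n * ‖y 0 - qstar‖)) := by gcongr
        _ = (|1 - β| + β * k) * (L ^ n * ‖y 0 - qstar‖) := by ring
        _ = L ^ (n + 1) * ‖y 0 - qstar‖ := by rw [← hL]; ring
    refine ⟨hyn, ?_⟩
    have hyn' : ‖y (n + 1) - qstar‖ ≤ L ^ n * ‖y 0 - qstar‖ :=
      hyn.trans (mul_le_mul_of_nonneg_right
        (pow_le_pow_of_le_one hL0 hL1 n.le_succ) (norm_nonneg _))
    rw [hz]
    calc _ ≤ |1 - β| * ‖z n - qstar‖ + β * (k * ‖y (n + 1) - qstar‖) :=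
          norm_relaxed_step_sub_le hf hq hβ0.le _ _
      _ ≤ |1 - β| * (L ^ n * ‖y 0 - qstar‖) + β * (k * (L ^ n * ‖y 0 - qstar‖)) := by gcongr
      _ = (|1 - β| + β * k) * (L ^ n * ‖y 0 - qstar‖) := by ring
      _ = L ^ (n + 1) * ‖y 0 - qstar‖ := by rw [← hL]; ring
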